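/- arXiv:2004.02497 — 2 statements merged into one kernel-verified Lean document; each statement's English description precedes it below -/
import Mathlib

section
/- For all integers l, l' ≥ m ≥ 0, the associated Legendre functions of common order m satisfy the orthogonality relation ∫_{−1}^{1} P_l^m(x) P_{l'}^m(x) dx = (2/(2l+1)) · ((l+m)!/(l−m)!) if l = l', and ∫_{−1}^{1} P_l^m(x) P_{l'}^m(x) dx = 0 if l ≠ l'. -/
open MeasureTheory Real Set intervalIntegral

/-- Legendre polynomial `P_l(x) = (1/(2^l l!)) (d/dx)^l (x²-1)^l` (Rodrigues formula). -/
noncomputable def legendreP (l : ℕ) (x : ℝ) : ℝ :=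
  (1 / ((2 : ℝ) ^ l * (Nat.factorial l : ℝ))) *
    iteratedDeriv l (fun y : ℝ => (y ^ 2 - 1) ^ l) x

/-- Associated Legendre function `P_l^m(x) = (1-x²)^{m/2} (d/dx)^m P_l(x)`. -/
noncomputable def assocLegendre (l m : ℕ) (x : ℝ) : ℝ :=
  (1 - x ^ 2) ^ ((m : ℝ) / 2) * iteratedDeriv m (legendreP l) x

/-- Real spherical harmonic `Y_l^k` of degree `l` and order `k`, expressed in the spherical
coordinates `Ω(μ,φ)`: `Y_l^k(Ω(μ,φ)) = C_{l,|k|} P_l^{|k|}(μ) t_k(φ)`. -/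
noncomputable def sphHarm (l : ℕ) (k : ℤ) (μ φ : ℝ) : ℝ :=
  ((-1 : ℝ) ^ k.natAbs *
      Real.sqrt ((2 * (l : ℝ) + 1) / (2 * Real.pi) *
        ((Nat.factorial (l - k.natAbs) : ℝ) / (Nat.factorial (l + k.natAbs) : ℝ)))) *
    assocLegendre l k.natAbs μ *
    (if 0 < k then Real.cos ((k.natAbs : ℝ) * φ)
     else if k = 0 then 1 / Real.sqrt 2
     else Real.sin ((k.natAbs : ℝ) * φ))

namespace AssocLegendre

open Polynomial

theorem iteratedDeriv_eval (p : ℝ[X]) (n : ℕ) :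
    iteratedDeriv n (fun x => p.eval x) = fun x => (derivative^[n] p).eval x := by
  induction n with
  | zero => simp
  | succ n ih =>
    rw [iteratedDeriv_succ, ih, Function.iterate_succ_apply']
    ext x
    exact Polynomial.deriv _

theorem integral_eval_derivative (p : ℝ[X]) (a b : ℝ) :
    ∫ x in a..b, (derivative p).eval x = p.eval b - p.eval a :=
  integral_eq_sub_of_hasDerivAt (fun x _ => p.hasDerivAt x)
    ((derivative p).continuous.intervalIntegrable _ _)

/-- Repeated integration by parts for polynomials without boundary terms. -/
theorem integral_mul_iterate_derivative (a b : ℝ) (k : ℕ) (f g : ℝ[X])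
    (h : ∀ i j, i + j + 1 = k → ∀ x ∈ ({a, b} : Set ℝ),
      (derivative^[i] f * derivative^[j] g).eval x = 0) :
    ∫ x in a..b, (f * derivative^[k] g).eval x =
      (-1) ^ k * ∫ x in a..b, (derivative^[k] f * g).eval x := by
  induction k generalizing f with
  | zero => simp
  | succ k ih =>
    have hparts : ∫ x in a..b, (f * derivative^[k + 1] g).eval x =
        -∫ x in a..b, (derivative f * derivative^[k] g).eval x := by
      have hftc := integral_eval_derivative (f * derivative^[k] g) a b
      have ha := h 0 k (by omega) a (by simp)
      have hb := h 0 k (by omega) b (by simp)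
      simp only [Function.iterate_zero, id_eq] at ha hb
      rw [ha, hb, derivative_mul, ← Function.iterate_succ_apply' derivative] at hftc
      simp only [eval_add] at hftc
      rw [intervalIntegral.integral_add
        (Polynomial.continuous _ |>.intervalIntegrable _ _)
        (Polynomial.continuous _ |>.intervalIntegrable _ _)] at hftc
      linarith
    rw [hparts, ih (derivative f), Function.iterate_succ_apply, pow_succ]
    · ring
    · intro i j hij x hx
      rw [← Function.iterate_succ_apply]
      exact h (i + 1) j (by omega) x hx

theorem eval_iterate_derivative_eq_zero_of_pow_dvd {p q : ℝ[X]} {n k : ℕ} {x : ℝ}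
    (hx : q.eval x = 0) (hdvd : q ^ n ∣ p) (hk : k < n) :
    (derivative^[k] p).eval x = 0 := by
  have h : q ∣ derivative^[k] p :=
    (dvd_pow_self q (by omega)).trans (pow_sub_dvd_iterate_derivative_of_pow_dvd k hdvd)
  exact eval_eq_zero_of_dvd_of_eval_eq_zero h hx

theorem iterate_derivative_eq_C {p : ℝ[X]} {n : ℕ} (hp : p.natDegree ≤ n) :
    derivative^[n] p = C ((n.factorial : ℝ) * p.coeff n) := by
  have h0 : (derivative^[n] p).natDegree = 0 := by
    have := natDegree_iterate_derivative p n
    omega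
  rw [eq_C_of_natDegree_eq_zero h0, coeff_iterate_derivative]
  simp [Nat.descFactorial_self]

theorem natDegree_X_sq_sub_one_pow (n : ℕ) : ((X ^ 2 - 1 : ℝ[X]) ^ n).natDegree = 2 * n := by
  rw [natDegree_pow, ← C_1, natDegree_X_pow_sub_C, mul_comm]

theorem coeff_X_sq_sub_one_pow (n : ℕ) : ((X ^ 2 - 1 : ℝ[X]) ^ n).coeff (2 * n) = 1 := by
  have h : (X ^ 2 - 1 : ℝ[X]).Monic := by
    rw [← C_1]
    exact monic_X_pow_sub_C 1 two_ne_zero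
  rw [← natDegree_X_sq_sub_one_pow]
  exact h.pow n

theorem integral_X_sq_sub_one_pow (n : ℕ) :
    (∫ x in (-1 : ℝ)..1, ((X ^ 2 - 1 : ℝ[X]) ^ n).eval x) * ((2 * n + 1).factorial : ℝ) =
      (-1) ^ n * 2 ^ (2 * n + 1) * (n.factorial : ℝ) ^ 2 := by
  induction n with
  | zero => norm_num
  | succ n ih =>
    have hder : derivative (X * (X ^ 2 - 1 : ℝ[X]) ^ (n + 1)) =
        C (2 * n + 3 : ℝ) * (X ^ 2 - 1) ^ (n + 1) + C (2 * (n + 1) : ℝ) * (X ^ 2 - 1) ^ n := by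
      simp only [derivative_mul, derivative_X, derivative_pow, derivative_sub, derivative_one,
        map_add, map_mul, map_natCast, map_ofNat, map_one, Nat.add_sub_cancel]
      push_cast
      ring
    have hrec := integral_eval_derivative (X * (X ^ 2 - 1 : ℝ[X]) ^ (n + 1)) (-1) 1
    rw [hder] at hrec
    simp only [eval_add, eval_mul, eval_C] at hrec
    rw [intervalIntegral.integral_add
      ((Polynomial.continuous _).const_mul _ |>.intervalIntegrable _ _)
      ((Polynomial.continuous _).const_mul _ |>.intervalIntegrable _ _),
      intervalIntegral.integral_const_mul, intervalIntegral.integral_const_mul] at hrec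
    have hbd : (1 : ℝ) * ((X ^ 2 - 1 : ℝ[X]) ^ (n + 1)).eval 1 -
        (-1) * ((X ^ 2 - 1 : ℝ[X]) ^ (n + 1)).eval (-1) = 0 := by
      simp
    rw [eval_X, eval_X, hbd] at hrec
    have hf : ((2 * (n + 1) + 1).factorial : ℝ) =
        (2 * n + 3) * (2 * n + 2) * ((2 * n + 1).factorial : ℝ) := by
      rw [show 2 * (n + 1) + 1 = 2 * n + 1 + 1 + 1 by ring, Nat.factorial_succ, Nat.factorial_succ]
      push_cast
      ring
    rw [hf, Nat.factorial_succ n]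
    push_cast
    linear_combination (2 * n + 2) * ((2 * n + 1).factorial : ℝ) * hrec
      - (2 * n + 2) * (2 * (n + 1)) * ih

/-- `(x² - 1)ᵐ (d/dx)ˡ⁺ᵐ (x² - 1)ˡ`. -/
noncomputable def weighted (l m : ℕ) : ℝ[X] :=
  (X ^ 2 - 1) ^ m * derivative^[l + m] ((X ^ 2 - 1) ^ l)

theorem natDegree_iterate_derivative_X_sq_sub_one_pow_le (l m : ℕ) :
    (derivative^[l + m] ((X ^ 2 - 1 : ℝ[X]) ^ l)).natDegree ≤ l - m := by
  have := natDegree_iterate_derivative ((X ^ 2 - 1 : ℝ[X]) ^ l) (l + m)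
  rw [natDegree_X_sq_sub_one_pow] at this
  omega

theorem natDegree_weighted_le {l m : ℕ} (hl : m ≤ l) : (weighted l m).natDegree ≤ l + m := by
  refine natDegree_mul_le.trans ?_
  rw [natDegree_X_sq_sub_one_pow]
  have := natDegree_iterate_derivative_X_sq_sub_one_pow_le l m
  omega

theorem coeff_weighted {l m : ℕ} (hl : m ≤ l) :
    (weighted l m).coeff (l + m) * ((l - m).factorial : ℝ) = ((2 * l).factorial : ℝ) := by
  rw [weighted, show l + m = 2 * m + (l - m) by omega,
    coeff_mul_add_eq_of_natDegree_le (natDegree_X_sq_sub_one_pow m).le, coeff_X_sq_sub_one_pow,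
    coeff_iterate_derivative, show l - m + (2 * m + (l - m)) = 2 * l by omega,
    coeff_X_sq_sub_one_pow, one_mul, nsmul_one, mul_comm]
  · have := Nat.factorial_mul_descFactorial (n := 2 * l) (k := 2 * m + (l - m)) (by omega)
    rw [show 2 * l - (2 * m + (l - m)) = l - m by omega] at this
    exact_mod_cast this
  · rw [show 2 * m + (l - m) = l + m by omega]
    exact natDegree_iterate_derivative_X_sq_sub_one_pow_le l m

theorem integral_weighted_mul (l l' m : ℕ) :
    ∫ x in (-1 : ℝ)..1,
        (weighted l m * derivative^[l' + m] ((X ^ 2 - 1 : ℝ[X]) ^ l')).eval x =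
      (-1) ^ (l' + m) * ∫ x in (-1 : ℝ)..1,
        (derivative^[l' + m] (weighted l m) * (X ^ 2 - 1) ^ l').eval x := by
  refine integral_mul_iterate_derivative _ _ _ _ _ fun i j hij x hx => ?_
  have hx0 : (X ^ 2 - 1 : ℝ[X]).eval x = 0 := by
    rcases hx with rfl | rfl <;> simp
  rw [eval_mul]
  rcases lt_or_ge i m with hi | hi
  · rw [eval_iterate_derivative_eq_zero_of_pow_dvd (p := weighted l m) hx0 (Dvd.intro _ rfl) hi,
      zero_mul]
  · rw [eval_iterate_derivative_eq_zero_of_pow_dvd hx0 (dvd_refl ((X ^ 2 - 1 : ℝ[X]) ^ l'))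
      (by omega), mul_zero]

theorem integral_weighted_mul_of_lt {l l' m : ℕ} (hl : m ≤ l) (h : l < l') :
    ∫ x in (-1 : ℝ)..1,
      (weighted l m * derivative^[l' + m] ((X ^ 2 - 1 : ℝ[X]) ^ l')).eval x = 0 := by
  have := natDegree_weighted_le hl
  rw [integral_weighted_mul, iterate_derivative_eq_zero (by omega)]
  simp

theorem integral_weighted_mul_self {l m : ℕ} (hl : m ≤ l) :
    ∫ x in (-1 : ℝ)..1,
        (weighted l m * derivative^[l + m] ((X ^ 2 - 1 : ℝ[X]) ^ l)).eval x =
      (-1) ^ m * (2 ^ l * (l.factorial : ℝ)) ^ 2 *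
        (2 / (2 * (l : ℝ) + 1) * ((l + m).factorial / (l - m).factorial : ℝ)) := by
  rw [integral_weighted_mul, iterate_derivative_eq_C (natDegree_weighted_le hl)]
  simp only [eval_C_mul]
  rw [intervalIntegral.integral_const_mul]
  have hfac : ((2 * l + 1).factorial : ℝ) = (2 * l + 1) * ((2 * l).factorial : ℝ) := by
    rw [Nat.factorial_succ]
    push_cast
    ring
  have hne : ((2 * l).factorial : ℝ) ≠ 0 := by positivity
  have hne' : ((l - m).factorial : ℝ) ≠ 0 := by positivity
  have hcoeff := eq_div_of_mul_eq hne' (coeff_weighted hl)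
  have hint := eq_div_of_mul_eq (by positivity) (integral_X_sq_sub_one_pow l)
  have hsign : ((-1 : ℝ) ^ l) ^ 2 = 1 := by rw [← pow_mul, mul_comm, pow_mul]; simp
  rw [hcoeff, hint, hfac, pow_add, pow_succ, pow_mul']
  field_simp
  linear_combination hsign

theorem legendreP_eq_eval (l : ℕ) :
    legendreP l = fun x =>
      (C (1 / ((2 : ℝ) ^ l * (l.factorial : ℝ))) * derivative^[l] ((X ^ 2 - 1) ^ l)).eval x := by
  ext x
  have h := congrFun (iteratedDeriv_eval ((X ^ 2 - 1) ^ l) l) x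
  simp only [eval_pow, eval_sub, eval_X, eval_one] at h
  rw [legendreP, h, eval_C_mul]

theorem assocLegendre_eq (l m : ℕ) (x : ℝ) :
    assocLegendre l m x = (1 - x ^ 2) ^ ((m : ℝ) / 2) *
      (1 / ((2 : ℝ) ^ l * (l.factorial : ℝ)) *
        (derivative^[l + m] ((X ^ 2 - 1 : ℝ[X]) ^ l)).eval x) := by
  rw [assocLegendre, legendreP_eq_eval, iteratedDeriv_eval, iterate_derivative_C_mul,
    ← Function.iterate_add_apply, add_comm m l]
  simp only [eval_C_mul]

theorem integral_assocLegendre_mul (l l' m : ℕ) :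
    ∫ x in (-1 : ℝ)..1, assocLegendre l m x * assocLegendre l' m x =
      (-1) ^ m / ((2 ^ l * (l.factorial : ℝ)) * (2 ^ l' * (l'.factorial : ℝ))) *
        ∫ x in (-1 : ℝ)..1,
          (weighted l m * derivative^[l' + m] ((X ^ 2 - 1 : ℝ[X]) ^ l')).eval x := by
  rw [← intervalIntegral.integral_const_mul]
  refine intervalIntegral.integral_congr fun x hx => ?_
  rw [uIcc_of_le (by norm_num)] at hx
  have hnonneg : 0 ≤ 1 - x ^ 2 := by nlinarith [hx.1, hx.2]
  have hsq : (1 - x ^ 2) ^ ((m : ℝ) / 2) * (1 - x ^ 2) ^ ((m : ℝ) / 2) =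
      (-1) ^ m * (x ^ 2 - 1) ^ m := by
    rw [← mul_pow, ← Real.rpow_add_of_nonneg hnonneg (by positivity) (by positivity), add_halves,
      Real.rpow_natCast]
    congr 1
    ring
  simp only [assocLegendre_eq, weighted, eval_mul, eval_pow, eval_sub, eval_X, eval_one]
  rw [mul_mul_mul_comm, hsq]
  field_simp

end AssocLegendre

/-- orthogonality of the associated Legendre functions of common order `m`:
`∫_{-1}^1 P_l^m P_{l'}^m dx = (2/(2l+1))·((l+m)!/(l-m)!)` if `l = l'` and `0` otherwise. -/
theorem assocLegendre_orthogonality (m l l' : ℕ) (hl : m ≤ l) (hl' : m ≤ l') :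
    ∫ x in (-1 : ℝ)..1, assocLegendre l m x * assocLegendre l' m x =
      if l = l' then (2 / (2 * (l : ℝ) + 1)) *
        ((Nat.factorial (l + m) : ℝ) / (Nat.factorial (l - m) : ℝ))
      else 0 := by
  rcases lt_trichotomy l l' with h | rfl | h
  · rw [if_neg h.ne, AssocLegendre.integral_assocLegendre_mul,
      AssocLegendre.integral_weighted_mul_of_lt hl h, mul_zero]
  · rw [if_pos rfl, AssocLegendre.integral_assocLegendre_mul,
      AssocLegendre.integral_weighted_mul_self hl]
    have hsign : ((-1 : ℝ) ^ m) ^ 2 = 1 := by rw [← pow_mul, mul_comm, pow_mul]; simp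
    field_simp
    linear_combination hsign
  · simp_rw [mul_comm (assocLegendre l m _)]
    rw [if_neg h.ne', AssocLegendre.integral_assocLegendre_mul,
      AssocLegendre.integral_weighted_mul_of_lt hl' h, mul_zero]
end

section
/- The real spherical harmonics form an orthonormal family: for all integers l, l' ≥ 0 and integers k, k' with |k| ≤ l and |k'| ≤ l', ∫_{−1}^{1} ∫_{0}^{2π} Y_l^k(Ω(μ,φ)) Y_{l'}^{k'}(Ω(μ,φ)) dφ dμ equals 1 if (l,k) = (l',k') and 0 otherwise. -/
open MeasureTheory Real Set intervalIntegral

section Polynomial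

open Polynomial

theorem iteratedDeriv_polynomial_eval (p : ℝ[X]) (n : ℕ) :
    iteratedDeriv n (fun x => p.eval x) = fun x => (derivative^[n] p).eval x := by
  induction n with
  | zero => simp
  | succ n ih =>
    rw [iteratedDeriv_succ, ih, Function.iterate_succ_apply']
    ext x
    exact Polynomial.deriv _

theorem legendreP_eq_eval (l : ℕ) :
    legendreP l = fun x => (C (1 / ((2 : ℝ) ^ l * (Nat.factorial l : ℝ))) *
      derivative^[l] ((X ^ 2 - 1) ^ l)).eval x := by
  ext x
  have h : (fun y : ℝ => (y ^ 2 - 1) ^ l) = fun y => ((X ^ 2 - 1 : ℝ[X]) ^ l).eval y := by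
    ext y; simp
  rw [legendreP, h, iteratedDeriv_polynomial_eval, eval_mul, eval_C]

theorem assocLegendre_eq_eval (l m : ℕ) (x : ℝ) :
    assocLegendre l m x = (1 - x ^ 2) ^ ((m : ℝ) / 2) *
      (1 / ((2 : ℝ) ^ l * (Nat.factorial l : ℝ)) *
        (derivative^[l + m] ((X ^ 2 - 1 : ℝ[X]) ^ l)).eval x) := by
  rw [assocLegendre, legendreP_eq_eval, iteratedDeriv_polynomial_eval]
  simp only [iterate_derivative_C_mul, ← Function.iterate_add_apply, eval_mul, eval_C, add_comm m l]

/-- Repeated integration by parts for polynomials, with all boundary terms vanishing. -/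
theorem integral_eval_iterate_derivative_mul {a b : ℝ} (n : ℕ) (p q : ℝ[X])
    (ha : ∀ i j, i + j + 1 = n → (derivative^[i] p).eval a * (derivative^[j] q).eval a = 0)
    (hb : ∀ i j, i + j + 1 = n → (derivative^[i] p).eval b * (derivative^[j] q).eval b = 0) :
    ∫ x in a..b, (derivative^[n] p).eval x * q.eval x =
      (-1) ^ n * ∫ x in a..b, p.eval x * (derivative^[n] q).eval x := by
  induction n generalizing q with
  | zero => simp
  | succ n ih =>
    have hq := ih (derivative q)
      (fun i j h => by simpa using ha i (j + 1) (by omega))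
      (fun i j h => by simpa using hb i (j + 1) (by omega))
    have hparts := integral_deriv_mul_eq_sub (a := a) (b := b)
      (fun x _ => (derivative^[n] p).hasDerivAt x) (fun x _ => q.hasDerivAt x)
      ((Polynomial.continuous _).intervalIntegrable _ _)
      ((Polynomial.continuous _).intervalIntegrable _ _)
    have ha0 := ha n 0 (by omega)
    have hb0 := hb n 0 (by omega)
    simp only [Function.iterate_zero, id_eq] at ha0 hb0
    rw [ha0, hb0, integral_add (Continuous.intervalIntegrable (by fun_prop) _ _)
      (Continuous.intervalIntegrable (by fun_prop) _ _), hq] at hparts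
    rw [Function.iterate_succ_apply', Function.iterate_succ_apply, pow_succ]
    linarith

theorem eval_iterate_derivative_eq_zero_of_pow_dvd {p q : ℝ[X]} {n i : ℕ} {a : ℝ}
    (hp : p ^ n ∣ q) (ha : p.eval a = 0) (hi : i < n) : (derivative^[i] q).eval a = 0 := by
  obtain ⟨r, hr⟩ := pow_sub_dvd_iterate_derivative_of_pow_dvd i hp
  rw [hr, eval_mul, eval_pow, ha, zero_pow (by omega), zero_mul]

theorem integral_one_sub_sq_pow_succ (n : ℕ) :
    (2 * (n : ℝ) + 3) * ∫ x in (-1 : ℝ)..1, (1 - x ^ 2) ^ (n + 1) =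
      2 * ((n : ℝ) + 1) * ∫ x in (-1 : ℝ)..1, (1 - x ^ 2) ^ n := by
  have hderiv : ∀ x ∈ uIcc (-1 : ℝ) 1, HasDerivAt (fun x : ℝ => x * (1 - x ^ 2) ^ (n + 1))
      ((2 * (n : ℝ) + 3) * (1 - x ^ 2) ^ (n + 1) - 2 * ((n : ℝ) + 1) * (1 - x ^ 2) ^ n) x := by
    intro x _
    have h := (hasDerivAt_id x).mul ((((hasDerivAt_id x).pow 2).const_sub 1).pow (n + 1))
    refine h.congr_deriv ?_
    simp
    ring
  have h := integral_eq_sub_of_hasDerivAt hderiv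
    (Continuous.intervalIntegrable (by fun_prop) _ _)
  rw [integral_sub (Continuous.intervalIntegrable (by fun_prop) _ _)
    (Continuous.intervalIntegrable (by fun_prop) _ _),
    intervalIntegral.integral_const_mul, intervalIntegral.integral_const_mul] at h
  norm_num at h
  linarith

theorem integral_one_sub_sq_pow (n : ℕ) :
    ∫ x in (-1 : ℝ)..1, (1 - x ^ 2) ^ n =
      2 * (2 ^ n * (Nat.factorial n : ℝ)) ^ 2 / (Nat.factorial (2 * n + 1) : ℝ) := by
  induction n with
  | zero => norm_num
  | succ n ih =>
    have h := integral_one_sub_sq_pow_succ n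
    rw [ih] at h
    have h3 : (2 * (n : ℝ) + 3) ≠ 0 := by positivity
    apply mul_left_cancel₀ h3
    rw [h, show 2 * (n + 1) + 1 = (2 * n + 1) + 1 + 1 by ring, Nat.factorial_succ (2 * n + 1 + 1),
      Nat.factorial_succ (2 * n + 1), Nat.factorial_succ n]
    have := Nat.factorial_ne_zero (2 * n + 1)
    push_cast
    field_simp
    ring

theorem natDegree_X_sq_sub_one_pow (l : ℕ) : ((X ^ 2 - 1 : ℝ[X]) ^ l).natDegree = 2 * l := by
  rw [natDegree_pow, show (X ^ 2 - 1 : ℝ[X]) = X ^ 2 - C 1 by simp, natDegree_X_pow_sub_C, mul_comm]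

theorem monic_X_sq_sub_one_pow (l : ℕ) : ((X ^ 2 - 1 : ℝ[X]) ^ l).Monic := by
  rw [show (X ^ 2 - 1 : ℝ[X]) = X ^ 2 - C 1 by simp]
  exact (monic_X_pow_sub_C _ two_ne_zero).pow l

theorem natDegree_weight_mul_le {l m : ℕ} (h : m ≤ l) :
    ((X ^ 2 - 1 : ℝ[X]) ^ m * derivative^[l + m] ((X ^ 2 - 1) ^ l)).natDegree ≤ l + m := by
  refine natDegree_mul_le.trans ?_
  have := natDegree_iterate_derivative ((X ^ 2 - 1 : ℝ[X]) ^ l) (l + m)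
  rw [natDegree_X_sq_sub_one_pow] at *
  omega

theorem coeff_weight_mul {l m : ℕ} (h : m ≤ l) :
    ((X ^ 2 - 1 : ℝ[X]) ^ m * derivative^[l + m] ((X ^ 2 - 1) ^ l)).coeff (l + m) =
      (Nat.factorial (2 * l) : ℝ) / (Nat.factorial (l - m) : ℝ) := by
  have hdeg := natDegree_iterate_derivative ((X ^ 2 - 1 : ℝ[X]) ^ l) (l + m)
  rw [natDegree_X_sq_sub_one_pow] at hdeg
  have hsum : l - m + (l + m) = 2 * l := by omega
  have hcoeff := coeff_mul_add_eq_of_natDegree_le (natDegree_X_sq_sub_one_pow m).le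
    (hdeg.trans (by omega : 2 * l - (l + m) ≤ l - m))
  rw [show 2 * m + (l - m) = l + m by omega] at hcoeff
  rw [hcoeff, coeff_iterate_derivative, hsum]
  have h1 : ∀ k, ((X ^ 2 - 1 : ℝ[X]) ^ k).coeff (2 * k) = 1 := fun k => by
    have hk := (monic_X_sq_sub_one_pow k).coeff_natDegree
    rwa [natDegree_X_sq_sub_one_pow] at hk
  rw [h1, h1, one_mul, nsmul_eq_mul, mul_one, Nat.descFactorial_eq_div (by omega),
    Nat.cast_div (Nat.factorial_dvd_factorial (by omega)) (by positivity),
    show 2 * l - (l + m) = l - m by omega]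

theorem integral_weight_mul_iterate_derivative (l m : ℕ) (q : ℝ[X]) :
    ∫ x in (-1 : ℝ)..1, (derivative^[l + m] ((X ^ 2 - 1 : ℝ[X]) ^ l)).eval x *
        ((X ^ 2 - 1) ^ m * q).eval x =
      (-1) ^ (l + m) * ∫ x in (-1 : ℝ)..1, ((X ^ 2 - 1 : ℝ[X]) ^ l).eval x *
        (derivative^[l + m] ((X ^ 2 - 1) ^ m * q)).eval x := by
  have key : ∀ a : ℝ, (X ^ 2 - 1 : ℝ[X]).eval a = 0 → ∀ i j, i + j + 1 = l + m →
      (derivative^[i] ((X ^ 2 - 1 : ℝ[X]) ^ l)).eval a *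
        (derivative^[j] ((X ^ 2 - 1) ^ m * q)).eval a = 0 := by
    intro a ha i j hij
    rcases lt_or_ge i l with hi | hi
    · rw [eval_iterate_derivative_eq_zero_of_pow_dvd (dvd_refl ((X ^ 2 - 1 : ℝ[X]) ^ l)) ha hi,
        zero_mul]
    · rw [eval_iterate_derivative_eq_zero_of_pow_dvd (dvd_mul_right ((X ^ 2 - 1 : ℝ[X]) ^ m) q) ha
        (by omega : j < m), mul_zero]
  exact integral_eval_iterate_derivative_mul _ _ _ (key _ (by simp)) (key _ (by simp))

theorem assocLegendre_mul_assocLegendre (l l' m : ℕ) {x : ℝ} (hx : x ∈ Icc (-1 : ℝ) 1) :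
    assocLegendre l m x * assocLegendre l' m x =
      (-1) ^ m * (1 / ((2 : ℝ) ^ l * (Nat.factorial l : ℝ)) *
        (1 / ((2 : ℝ) ^ l' * (Nat.factorial l' : ℝ)))) *
      ((derivative^[l + m] ((X ^ 2 - 1 : ℝ[X]) ^ l)).eval x *
        ((X ^ 2 - 1 : ℝ[X]) ^ m * derivative^[l' + m] ((X ^ 2 - 1) ^ l')).eval x) := by
  have h0 : 0 ≤ 1 - x ^ 2 := by nlinarith [hx.1, hx.2]
  have hw : (1 - x ^ 2) ^ ((m : ℝ) / 2) * (1 - x ^ 2) ^ ((m : ℝ) / 2) =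
      (-1) ^ m * (x ^ 2 - 1) ^ m := by
    rw [← mul_pow, ← Real.rpow_add_of_nonneg h0 (by positivity) (by positivity), add_halves,
      Real.rpow_natCast]
    congr 1; ring
  rw [assocLegendre_eq_eval, assocLegendre_eq_eval, eval_mul,
    show ((X ^ 2 - 1 : ℝ[X]) ^ m).eval x = (x ^ 2 - 1) ^ m by simp]
  linear_combination (1 / ((2 : ℝ) ^ l * (Nat.factorial l : ℝ)) *
        (derivative^[l + m] ((X ^ 2 - 1 : ℝ[X]) ^ l)).eval x) *
      (1 / ((2 : ℝ) ^ l' * (Nat.factorial l' : ℝ)) *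
        (derivative^[l' + m] ((X ^ 2 - 1 : ℝ[X]) ^ l')).eval x) * hw

theorem integral_assocLegendre_mul (l l' m : ℕ) :
    ∫ x in (-1 : ℝ)..1, assocLegendre l m x * assocLegendre l' m x =
      (-1) ^ m * (1 / ((2 : ℝ) ^ l * (Nat.factorial l : ℝ)) *
        (1 / ((2 : ℝ) ^ l' * (Nat.factorial l' : ℝ)))) *
      ((-1) ^ (l + m) * ∫ x in (-1 : ℝ)..1, ((X ^ 2 - 1 : ℝ[X]) ^ l).eval x *
        (derivative^[l + m] ((X ^ 2 - 1) ^ m *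
          derivative^[l' + m] ((X ^ 2 - 1) ^ l'))).eval x) := by
  rw [← integral_weight_mul_iterate_derivative, ← intervalIntegral.integral_const_mul]
  refine integral_congr fun x hx => assocLegendre_mul_assocLegendre l l' m ?_
  rwa [uIcc_of_le (by norm_num)] at hx

theorem integral_assocLegendre_mul_of_lt {l l' m : ℕ} (hm : m ≤ l') (h : l' < l) :
    ∫ x in (-1 : ℝ)..1, assocLegendre l m x * assocLegendre l' m x = 0 := by
  rw [integral_assocLegendre_mul, iterate_derivative_eq_zero
    ((natDegree_weight_mul_le hm).trans_lt (by omega))]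
  simp

theorem integral_assocLegendre_mul_of_ne {l l' m : ℕ} (hm : m ≤ l) (hm' : m ≤ l') (h : l ≠ l') :
    ∫ x in (-1 : ℝ)..1, assocLegendre l m x * assocLegendre l' m x = 0 := by
  rcases h.lt_or_gt with h | h
  · simp_rw [mul_comm (assocLegendre l m _)]
    exact integral_assocLegendre_mul_of_lt hm h
  · exact integral_assocLegendre_mul_of_lt hm' h

theorem integral_assocLegendre_mul_self {l m : ℕ} (hm : m ≤ l) :
    ∫ x in (-1 : ℝ)..1, assocLegendre l m x * assocLegendre l m x =
      2 / (2 * (l : ℝ) + 1) * ((Nat.factorial (l + m) : ℝ) / (Nat.factorial (l - m) : ℝ)) := by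
  have hconst : ∀ x : ℝ, (derivative^[l + m] ((X ^ 2 - 1 : ℝ[X]) ^ m *
      derivative^[l + m] ((X ^ 2 - 1) ^ l))).eval x =
      (Nat.factorial (l + m) : ℝ) * ((Nat.factorial (2 * l) : ℝ) / (Nat.factorial (l - m) : ℝ)) := by
    intro x
    have hd := natDegree_iterate_derivative ((X ^ 2 - 1 : ℝ[X]) ^ m *
      derivative^[l + m] ((X ^ 2 - 1) ^ l)) (l + m)
    have hd' := natDegree_weight_mul_le hm
    rw [eq_C_of_natDegree_eq_zero (p := derivative^[l + m] _) (by omega), eval_C,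
      coeff_iterate_derivative, zero_add, coeff_weight_mul hm, Nat.descFactorial_self, nsmul_eq_mul]
  have heval : ∀ x : ℝ, ((X ^ 2 - 1 : ℝ[X]) ^ l).eval x = (-1) ^ l * (1 - x ^ 2) ^ l := by
    intro x
    rw [← mul_pow]
    simp
  rw [integral_assocLegendre_mul]
  simp_rw [hconst, heval]
  rw [intervalIntegral.integral_mul_const, intervalIntegral.integral_const_mul,
    integral_one_sub_sq_pow, Nat.factorial_succ]
  have hl : ((-1 : ℝ) ^ l) ^ 2 = 1 := by rw [← pow_mul, mul_comm, pow_mul]; simp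
  have hm1 : ((-1 : ℝ) ^ m) ^ 2 = 1 := by rw [← pow_mul, mul_comm, pow_mul]; simp
  have h1 := Nat.factorial_ne_zero l
  have h2 := Nat.factorial_ne_zero (2 * l)
  have h3 := Nat.factorial_ne_zero (l - m)
  rw [pow_add]
  push_cast
  field_simp
  rw [hl, hm1]
  ring

end Polynomial

section Angular

/-- The azimuthal factor of the real spherical harmonic of order `k`. -/
noncomputable def azimuthal (k : ℤ) (φ : ℝ) : ℝ :=
  if 0 < k then Real.cos ((k.natAbs : ℝ) * φ)
  else if k = 0 then 1 / Real.sqrt 2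
  else Real.sin ((k.natAbs : ℝ) * φ)

theorem integral_cos_int_mul (n : ℤ) :
    ∫ φ in (0 : ℝ)..(2 * π), Real.cos (n * φ) = if n = 0 then 2 * π else 0 := by
  split_ifs with h
  · simp [h]
  · have hn : (n : ℝ) ≠ 0 := by exact_mod_cast h
    rw [integral_comp_mul_left (fun x => Real.cos x) hn, integral_cos, ← mul_assoc,
      show (n : ℝ) * 2 * π = (n * 2 : ℤ) * π by push_cast; ring, Real.sin_int_mul_pi]
    simp

theorem integral_sin_int_mul (n : ℤ) : ∫ φ in (0 : ℝ)..(2 * π), Real.sin (n * φ) = 0 := by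
  by_cases h : n = 0
  · simp [h]
  · have hn : (n : ℝ) ≠ 0 := by exact_mod_cast h
    rw [integral_comp_mul_left (fun x => Real.sin x) hn, integral_sin, Real.cos_int_mul_two_pi]
    simp

theorem integral_cos_mul_cos_int (a b : ℤ) :
    ∫ φ in (0 : ℝ)..(2 * π), Real.cos (a * φ) * Real.cos (b * φ) =
      (if a = b then π else 0) + if a = -b then π else 0 := by
  have h : ∀ φ : ℝ, Real.cos (a * φ) * Real.cos (b * φ) =
      1 / 2 * Real.cos ((a - b : ℤ) * φ) + 1 / 2 * Real.cos ((a + b : ℤ) * φ) := fun φ => by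
    push_cast
    rw [sub_mul, add_mul, Real.cos_sub, Real.cos_add]
    ring
  simp_rw [h]
  rw [integral_add (Continuous.intervalIntegrable (by fun_prop) _ _)
    (Continuous.intervalIntegrable (by fun_prop) _ _),
    intervalIntegral.integral_const_mul, intervalIntegral.integral_const_mul,
    integral_cos_int_mul, integral_cos_int_mul]
  simp only [sub_eq_zero, add_eq_zero_iff_eq_neg]
  split_ifs <;> ring

theorem integral_sin_mul_sin_int (a b : ℤ) :
    ∫ φ in (0 : ℝ)..(2 * π), Real.sin (a * φ) * Real.sin (b * φ) =
      (if a = b then π else 0) - if a = -b then π else 0 := by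
  have h : ∀ φ : ℝ, Real.sin (a * φ) * Real.sin (b * φ) =
      1 / 2 * Real.cos ((a - b : ℤ) * φ) - 1 / 2 * Real.cos ((a + b : ℤ) * φ) := fun φ => by
    push_cast
    rw [sub_mul, add_mul, Real.cos_sub, Real.cos_add]
    ring
  simp_rw [h]
  rw [integral_sub (Continuous.intervalIntegrable (by fun_prop) _ _)
    (Continuous.intervalIntegrable (by fun_prop) _ _),
    intervalIntegral.integral_const_mul, intervalIntegral.integral_const_mul,
    integral_cos_int_mul, integral_cos_int_mul]
  simp only [sub_eq_zero, add_eq_zero_iff_eq_neg]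
  split_ifs <;> ring

theorem integral_sin_mul_cos_int (a b : ℤ) :
    ∫ φ in (0 : ℝ)..(2 * π), Real.sin (a * φ) * Real.cos (b * φ) = 0 := by
  have h : ∀ φ : ℝ, Real.sin (a * φ) * Real.cos (b * φ) =
      1 / 2 * Real.sin ((a - b : ℤ) * φ) + 1 / 2 * Real.sin ((a + b : ℤ) * φ) := fun φ => by
    push_cast
    rw [sub_mul, add_mul, Real.sin_sub, Real.sin_add]
    ring
  simp_rw [h]
  rw [integral_add (Continuous.intervalIntegrable (by fun_prop) _ _)
    (Continuous.intervalIntegrable (by fun_prop) _ _),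
    intervalIntegral.integral_const_mul, intervalIntegral.integral_const_mul,
    integral_sin_int_mul, integral_sin_int_mul]
  simp

theorem azimuthal_of_pos {k : ℤ} (hk : 0 < k) : azimuthal k = fun φ => Real.cos (k * φ) := by
  ext φ
  rw [azimuthal, if_pos hk, Nat.cast_natAbs, abs_of_pos hk]

theorem azimuthal_of_neg {k : ℤ} (hk : k < 0) :
    azimuthal k = fun φ => Real.sin ((-k : ℤ) * φ) := by
  ext φ
  rw [azimuthal, if_neg hk.not_gt, if_neg hk.ne, Nat.cast_natAbs, abs_of_neg hk]

theorem azimuthal_zero : azimuthal 0 = fun φ => 1 / √2 * Real.cos ((0 : ℤ) * φ) := by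
  ext φ
  simp [azimuthal]

theorem integral_azimuthal_mul (k k' : ℤ) :
    ∫ φ in (0 : ℝ)..(2 * π), azimuthal k φ * azimuthal k' φ = if k = k' then π else 0 := by
  rcases lt_trichotomy k 0 with hk | rfl | hk <;> rcases lt_trichotomy k' 0 with hk' | rfl | hk'
  · simp only [azimuthal_of_neg hk, azimuthal_of_neg hk', integral_sin_mul_sin_int, neg_inj]
    rw [if_neg (show ¬k = -k' by omega), sub_zero]
  · simp only [azimuthal_of_neg hk, azimuthal_zero, mul_left_comm _ (1 / √2),
      intervalIntegral.integral_const_mul, integral_sin_mul_cos_int, mul_zero, if_neg hk.ne]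
  · simp only [azimuthal_of_neg hk, azimuthal_of_pos hk', integral_sin_mul_cos_int]
    rw [if_neg (by omega)]
  · simp only [azimuthal_of_neg hk', azimuthal_zero, mul_assoc,
      intervalIntegral.integral_const_mul, mul_comm (Real.cos _), integral_sin_mul_cos_int,
      mul_zero, if_neg hk'.ne']
  · have h2 : 1 / √2 * (1 / √2) = (1 / 2 : ℝ) := by
      rw [div_mul_div_comm, Real.mul_self_sqrt zero_le_two, one_mul]
    simp only [azimuthal_zero, mul_mul_mul_comm (1 / √2) _ (1 / √2), h2,
      intervalIntegral.integral_const_mul, integral_cos_mul_cos_int, neg_zero, if_true]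
    ring
  · simp only [azimuthal_of_pos hk', azimuthal_zero, mul_assoc,
      intervalIntegral.integral_const_mul, integral_cos_mul_cos_int, if_neg hk'.ne,
      if_neg (show ¬0 = -k' by omega), add_zero, mul_zero]
  · simp only [azimuthal_of_neg hk', azimuthal_of_pos hk, mul_comm (Real.cos _),
      integral_sin_mul_cos_int]
    rw [if_neg (by omega)]
  · simp only [azimuthal_of_pos hk, azimuthal_zero, mul_left_comm _ (1 / √2),
      intervalIntegral.integral_const_mul, integral_cos_mul_cos_int, neg_zero, if_neg hk.ne',
      add_zero, mul_zero]
  · simp only [azimuthal_of_pos hk, azimuthal_of_pos hk', integral_cos_mul_cos_int]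
    rw [if_neg (show ¬k = -k' by omega), add_zero]

end Angular

/-- The normalization constant `C_{l,m}` of the real spherical harmonics. -/
noncomputable def sphHarmNorm (l m : ℕ) : ℝ :=
  (-1 : ℝ) ^ m * Real.sqrt ((2 * (l : ℝ) + 1) / (2 * Real.pi) *
    ((Nat.factorial (l - m) : ℝ) / (Nat.factorial (l + m) : ℝ)))

theorem sphHarmNorm_mul_self (l m : ℕ) :
    sphHarmNorm l m * sphHarmNorm l m = (2 * (l : ℝ) + 1) / (2 * Real.pi) *
      ((Nat.factorial (l - m) : ℝ) / (Nat.factorial (l + m) : ℝ)) := by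
  rw [sphHarmNorm, mul_mul_mul_comm, Real.mul_self_sqrt (by positivity), ← mul_pow]
  simp

theorem sphHarm_eq (l : ℕ) (k : ℤ) (μ φ : ℝ) :
    sphHarm l k μ φ = sphHarmNorm l k.natAbs * assocLegendre l k.natAbs μ * azimuthal k φ :=
  rfl

/-- orthonormality of the real spherical harmonics:
`∫_{-1}^1 ∫_0^{2π} Y_l^k(Ω(μ,φ)) Y_{l'}^{k'}(Ω(μ,φ)) dφ dμ = δ_{ll'} δ_{kk'}`. -/
theorem sphHarm_orthonormal (l l' : ℕ) (k k' : ℤ)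
    (hk : |k| ≤ (l : ℤ)) (hk' : |k'| ≤ (l' : ℤ)) :
    (∫ μ in (-1 : ℝ)..1, ∫ φ in (0 : ℝ)..(2 * Real.pi),
        sphHarm l k μ φ * sphHarm l' k' μ φ) =
      if l = l' ∧ k = k' then 1 else 0 := by
  have hinner : ∀ μ : ℝ, (∫ φ in (0 : ℝ)..(2 * Real.pi), sphHarm l k μ φ * sphHarm l' k' μ φ) =
      sphHarmNorm l k.natAbs * sphHarmNorm l' k'.natAbs * (if k = k' then π else 0) *
        (assocLegendre l k.natAbs μ * assocLegendre l' k'.natAbs μ) := by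
    intro μ
    simp_rw [sphHarm_eq, mul_mul_mul_comm _ (azimuthal k _)]
    rw [intervalIntegral.integral_const_mul, integral_azimuthal_mul]
    ring
  simp_rw [hinner]
  rw [intervalIntegral.integral_const_mul]
  by_cases hkk : k = k'
  · subst hkk
    have hm : k.natAbs ≤ l := by exact_mod_cast (Int.natCast_natAbs k).trans_le hk
    have hm' : k.natAbs ≤ l' := by exact_mod_cast (Int.natCast_natAbs k).trans_le hk'
    by_cases hll : l = l'
    · subst hll
      rw [integral_assocLegendre_mul_self hm, sphHarmNorm_mul_self]
      have h1 := Nat.factorial_ne_zero (l + k.natAbs)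
      have h2 := Nat.factorial_ne_zero (l - k.natAbs)
      simp only [if_true, and_self]
      field_simp
    · rw [integral_assocLegendre_mul_of_ne hm hm' hll, mul_zero,
        if_neg (show ¬(l = l' ∧ k = k) from fun h => hll h.1)]
  · rw [if_neg hkk, if_neg (fun h => hkk h.2)]
    simp
end
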